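/- For each fixed τ ∈ ℝ the kernel satisfies the operator identity (d/dx)(x^{1/2}·(d/dx))·[ (x·(d/dx))² + τ² ]·𝒦(x,τ) = x^{−1/2}·𝒦(x,τ) for all x > 0, i.e. if L₁u = (x·u′)′·x evaluated as (x d/dx)²u = x·(x·u′)′ and L₂v = (x^{1/2}·v′)′, then L₂( (x d/dx)²𝒦 + τ²𝒦 ) = x^{−1/2}·𝒦. -/

import Mathlib

open MeasureTheory Set Filter Asymptotics

/-- Modified Bessel function of the second kind (integral representation, for Re z > 0). -/
noncomputable def besselK (nu z : ℂ) : ℂ :=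
  ∫ t in Set.Ioi (0:ℝ), Complex.exp (-z * (Real.cosh t : ℂ)) * Complex.cosh (nu * (t : ℂ))

/-- The kernel 𝒦(x,τ) = ker²_{2iτ}(2(4x)^{1/4}) + kei²_{2iτ}(2(4x)^{1/4})
    = K_{2iτ}(2(4x)^{1/4}e^{iπ/4}) · K_{2iτ}(2(4x)^{1/4}e^{-iπ/4}), which is real. -/
noncomputable def kernelK (x τ : ℝ) : ℝ :=
  (besselK (2 * Complex.I * (τ:ℂ))
      (((2 * (4*x) ^ ((1:ℝ)/4) : ℝ) : ℂ) * Complex.exp (Complex.I * (Real.pi:ℂ) / 4)) *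
   besselK (2 * Complex.I * (τ:ℂ))
      (((2 * (4*x) ^ ((1:ℝ)/4) : ℝ) : ℂ) * Complex.exp (-(Complex.I * (Real.pi:ℂ)) / 4))).re

/-- K₀(y) = ∫₀^∞ exp(−y·cosh t) dt. -/
noncomputable def besselK0 (y : ℝ) : ℝ := ∫ t in Set.Ioi (0:ℝ), Real.exp (-y * Real.cosh t)

/-- K_{iτ}(x) = ∫₀^∞ exp(−x·cosh t)·cos(τt) dt (real-valued, purely imaginary order). -/
noncomputable def besselKi (τ x : ℝ) : ℝ :=
  ∫ t in Set.Ioi (0:ℝ), Real.exp (-x * Real.cosh t) * Real.cos (τ * t)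

/-- Modified Bessel function of the first kind I_ν(z) (power series). -/
noncomputable def besselI (nu z : ℂ) : ℂ :=
  ∑' n : ℕ, (z/2) ^ (nu + 2*(n:ℂ)) / ((n.factorial : ℂ) * Complex.Gamma (nu + (n:ℂ) + 1))

/-- B_ν(w) = ber²_ν(w) + bei²_ν(w) = I_ν(w·e^{iπ/4})·I_ν(w·e^{−iπ/4}). -/
noncomputable def kelvinB (nu w : ℂ) : ℂ :=
  besselI nu (w * Complex.exp (Complex.I * (Real.pi:ℂ) / 4)) *
  besselI nu (w * Complex.exp (-(Complex.I * (Real.pi:ℂ)) / 4))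

/-- Index transform (1.1): (F f)(τ) = ∫₀^∞ 𝒦(x,τ) f(x) dx. -/
noncomputable def indexF (f : ℝ → ℝ) (τ : ℝ) : ℝ := ∫ x in Set.Ioi (0:ℝ), kernelK x τ * f x

/-- Index transform (1.2): (G g)(x) = ∫₀^∞ 𝒦(x,τ) g(τ) dτ. -/
noncomputable def indexG (g : ℝ → ℝ) (x : ℝ) : ℝ := ∫ τ in Set.Ioi (0:ℝ), kernelK x τ * g τ

/-- Index transform (1.2) for complex-valued densities. -/
noncomputable def indexGC (g : ℝ → ℂ) (x : ℝ) : ℂ :=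
  ∫ τ in Set.Ioi (0:ℝ), (kernelK x τ : ℂ) * g τ

/-- Mellin transform of a real function. -/
noncomputable def mellinT (f : ℝ → ℝ) (s : ℂ) : ℂ :=
  ∫ x in Set.Ioi (0:ℝ), (f x : ℂ) * (x:ℂ) ^ (s - 1)

/-- Mellin transform of a complex function. -/
noncomputable def mellinC (F : ℝ → ℂ) (s : ℂ) : ℂ :=
  ∫ x in Set.Ioi (0:ℝ), F x * (x:ℂ) ^ (s - 1)

/-- The L_{ν,p}(ℝ₊) norm. -/
noncomputable def Lnorm (ν p : ℝ) (f : ℝ → ℝ) : ℝ :=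
  (∫ x in Set.Ioi (0:ℝ), |f x| ^ p * x ^ (ν*p - 1)) ^ (1/p)

/-- Euler beta function B(a,b) = Γ(a)Γ(b)/Γ(a+b). -/
noncomputable def betaFn (a b : ℝ) : ℝ := Real.Gamma a * Real.Gamma b / Real.Gamma (a+b)

/-- The moments `∫₀^∞ cosh^k t · exp(−z cosh t) · cosh(ν t) dt`; up to sign these are the
derivatives of `besselK nu`. -/
noncomputable def besselKMoment (k : ℕ) (nu z : ℂ) : ℂ :=
  ∫ t in Set.Ioi (0:ℝ), (Real.cosh t : ℂ) ^ k *
    (Complex.exp (-z * (Real.cosh t : ℂ)) * Complex.cosh (nu * (t : ℂ)))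

theorem besselKMoment_zero (nu z : ℂ) : besselKMoment 0 nu z = besselK nu z := by
  simp [besselKMoment, besselK]

theorem eventually_mul_le_mul_cosh (A : ℝ) {δ : ℝ} (hδ : 0 < δ) :
    ∀ᶠ t : ℝ in atTop, A * t ≤ δ * Real.cosh t := by
  have h := (Real.tendsto_exp_div_pow_atTop 1).eventually_ge_atTop (2 * A / δ)
  filter_upwards [h, eventually_gt_atTop 0] with t ht ht0
  rw [pow_one, div_le_div_iff₀ hδ ht0] at ht
  rw [Real.cosh_eq]
  nlinarith [mul_pos hδ (Real.exp_pos (-t))]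

theorem Complex.norm_cosh_le_exp_norm (w : ℂ) : ‖Complex.cosh w‖ ≤ Real.exp ‖w‖ := by
  have h1 := Complex.norm_exp_le_exp_norm w
  have h2 := Complex.norm_exp_le_exp_norm (-w)
  rw [norm_neg] at h2
  rw [Complex.cosh, norm_div, Complex.norm_two]
  linarith [norm_add_le (Complex.exp w) (Complex.exp (-w))]

theorem Complex.norm_sinh_le_exp_norm (w : ℂ) : ‖Complex.sinh w‖ ≤ Real.exp ‖w‖ := by
  have h1 := Complex.norm_exp_le_exp_norm w
  have h2 := Complex.norm_exp_le_exp_norm (-w)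
  rw [norm_neg] at h2
  rw [Complex.sinh, norm_div, Complex.norm_two]
  linarith [norm_sub_le (Complex.exp w) (Complex.exp (-w))]

theorem Real.cosh_le_exp {t : ℝ} (ht : 0 ≤ t) : Real.cosh t ≤ Real.exp t := by
  rw [Real.cosh_eq]
  linarith [Real.exp_le_exp.2 (by linarith : -t ≤ t)]

theorem eventually_cosh_pow_mul_exp_le (k : ℕ) (c : ℝ) {δ : ℝ} (hδ : 0 < δ) :
    ∀ᶠ t : ℝ in atTop,
      Real.cosh t ^ k * (Real.exp (-δ * Real.cosh t) * Real.exp (c * t)) ≤ Real.exp (-t) := by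
  filter_upwards [eventually_mul_le_mul_cosh (k + c + 1) hδ, eventually_ge_atTop 0] with t ht ht0
  calc Real.cosh t ^ k * (Real.exp (-δ * Real.cosh t) * Real.exp (c * t))
      ≤ Real.exp t ^ k * (Real.exp (-δ * Real.cosh t) * Real.exp (c * t)) := by
        gcongr
        exact Real.cosh_le_exp ht0
    _ = Real.exp (k * t + (-δ * Real.cosh t + c * t)) := by
        rw [← Real.exp_nat_mul, ← Real.exp_add, ← Real.exp_add]
    _ ≤ Real.exp (-t) := Real.exp_le_exp.2 (by linarith)

theorem integrableOn_cosh_pow_mul_exp (k : ℕ) (c : ℝ) {δ : ℝ} (hδ : 0 < δ) :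
    IntegrableOn
      (fun t : ℝ => Real.cosh t ^ k * (Real.exp (-δ * Real.cosh t) * Real.exp (c * t)))
      (Ioi 0) := by
  refine integrable_of_isBigO_exp_neg (b := 1) one_pos (by fun_prop) (IsBigO.of_bound 1 ?_)
  filter_upwards [eventually_cosh_pow_mul_exp_le k c hδ] with t ht
  have hc := Real.cosh_pos t
  rwa [Real.norm_of_nonneg (by positivity), Real.norm_of_nonneg (by positivity), one_mul,
    neg_one_mul]

theorem norm_besselKMoment_integrand_le (k : ℕ) (nu : ℂ) {z : ℂ} {δ : ℝ} (hz : δ ≤ z.re)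
    {t : ℝ} (ht : 0 ≤ t) :
    ‖(Real.cosh t : ℂ) ^ k *
      (Complex.exp (-z * (Real.cosh t : ℂ)) * Complex.cosh (nu * (t : ℂ)))‖ ≤
    Real.cosh t ^ k * (Real.exp (-δ * Real.cosh t) * Real.exp (‖nu‖ * t)) := by
  have hc := Real.cosh_pos t
  rw [norm_mul, norm_mul, norm_pow, Complex.norm_of_nonneg hc.le, Complex.norm_exp,
    Complex.re_mul_ofReal, Complex.neg_re]
  have h := Complex.norm_cosh_le_exp_norm (nu * t)
  rw [norm_mul, Complex.norm_of_nonneg ht] at h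
  gcongr

theorem integrableOn_besselKMoment_integrand (k : ℕ) (nu : ℂ) {z : ℂ} (hz : 0 < z.re) :
    IntegrableOn (fun t : ℝ => (Real.cosh t : ℂ) ^ k *
      (Complex.exp (-z * (Real.cosh t : ℂ)) * Complex.cosh (nu * (t : ℂ)))) (Ioi 0) := by
  refine Integrable.mono' (integrableOn_cosh_pow_mul_exp k ‖nu‖ hz)
    (Continuous.aestronglyMeasurable (by fun_prop)) ?_
  filter_upwards [ae_restrict_mem measurableSet_Ioi] with t ht
  exact norm_besselKMoment_integrand_le k nu le_rfl (le_of_lt ht)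

theorem hasDerivAt_besselKMoment (k : ℕ) (nu : ℂ) {z : ℂ} (hz : 0 < z.re) :
    HasDerivAt (besselKMoment k nu) (-besselKMoment (k + 1) nu z) z := by
  have hs : {w : ℂ | z.re / 2 < w.re} ∈ nhds z :=
    (isOpen_lt continuous_const Complex.continuous_re).mem_nhds (half_lt_self hz)
  have key := hasDerivAt_integral_of_dominated_loc_of_deriv_le
    (μ := volume.restrict (Ioi (0:ℝ)))
    (F := fun (w : ℂ) (t : ℝ) => (Real.cosh t : ℂ) ^ k *
      (Complex.exp (-w * (Real.cosh t : ℂ)) * Complex.cosh (nu * (t : ℂ))))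
    (F' := fun (w : ℂ) (t : ℝ) => -((Real.cosh t : ℂ) ^ (k + 1) *
      (Complex.exp (-w * (Real.cosh t : ℂ)) * Complex.cosh (nu * (t : ℂ)))))
    (bound := fun t => Real.cosh t ^ (k + 1) *
      (Real.exp (-(z.re / 2) * Real.cosh t) * Real.exp (‖nu‖ * t)))
    hs
    (Eventually.of_forall fun w => Continuous.aestronglyMeasurable (by fun_prop))
    (integrableOn_besselKMoment_integrand k nu hz)
    (Continuous.aestronglyMeasurable (by fun_prop))
    (by
      filter_upwards [ae_restrict_mem measurableSet_Ioi] with t ht w hw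
      rw [norm_neg]
      exact norm_besselKMoment_integrand_le (k + 1) nu (le_of_lt hw) (le_of_lt ht))
    (integrableOn_cosh_pow_mul_exp (k + 1) ‖nu‖ (half_pos hz))
    (by
      refine Eventually.of_forall fun t w _ => ?_
      have h := (((hasDerivAt_neg w).mul_const (Real.cosh t : ℂ)).cexp.mul_const
        (Complex.cosh (nu * (t : ℂ)))).const_mul ((Real.cosh t : ℂ) ^ k)
      refine h.congr_deriv ?_
      ring)
  refine key.2.congr_deriv ?_
  rw [integral_neg, besselKMoment]

theorem tendsto_besselK_boundary_term (nu : ℂ) {z : ℂ} (hz : 0 < z.re) :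
    Tendsto (fun t : ℝ =>
      -z * Complex.sinh t * Complex.exp (-z * Complex.cosh t) * Complex.cosh (nu * t) -
        Complex.exp (-z * Complex.cosh t) * (nu * Complex.sinh (nu * t))) atTop (nhds 0) := by
  have hlim : Tendsto (fun t : ℝ => (‖z‖ + ‖nu‖) * Real.exp (-t)) atTop (nhds 0) := by
    simpa using Real.tendsto_exp_neg_atTop_nhds_zero.const_mul (‖z‖ + ‖nu‖)
  refine squeeze_zero_norm' ?_ hlim
  filter_upwards [eventually_cosh_pow_mul_exp_le 1 ‖nu‖ hz,
    eventually_cosh_pow_mul_exp_le 0 ‖nu‖ hz, eventually_ge_atTop 0] with t h1 h0 ht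
  have hE : ‖Complex.exp (-z * Complex.cosh t)‖ = Real.exp (-z.re * Real.cosh t) := by
    rw [← Complex.ofReal_cosh, Complex.norm_exp, Complex.re_mul_ofReal, Complex.neg_re]
  have hS : ‖Complex.sinh t‖ ≤ Real.cosh t := by
    rw [← Complex.ofReal_sinh, Complex.norm_of_nonneg (Real.sinh_nonneg_iff.2 ht)]
    exact (Real.sinh_lt_cosh t).le
  have hC := Complex.norm_cosh_le_exp_norm (nu * t)
  have hC' := Complex.norm_sinh_le_exp_norm (nu * t)
  rw [norm_mul, Complex.norm_of_nonneg ht] at hC hC'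
  rw [pow_one] at h1
  rw [pow_zero, one_mul] at h0
  have hc := Real.cosh_pos t
  refine (norm_sub_le _ _).trans ?_
  simp only [norm_mul, norm_neg, hE]
  calc ‖z‖ * ‖Complex.sinh t‖ * Real.exp (-z.re * Real.cosh t) * ‖Complex.cosh (nu * t)‖ +
        Real.exp (-z.re * Real.cosh t) * (‖nu‖ * ‖Complex.sinh (nu * t)‖)
      ≤ ‖z‖ * Real.cosh t * Real.exp (-z.re * Real.cosh t) * Real.exp (‖nu‖ * t) +
        Real.exp (-z.re * Real.cosh t) * (‖nu‖ * Real.exp (‖nu‖ * t)) := by gcongr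
    _ = ‖z‖ * (Real.cosh t * (Real.exp (-z.re * Real.cosh t) * Real.exp (‖nu‖ * t))) +
        ‖nu‖ * (Real.exp (-z.re * Real.cosh t) * Real.exp (‖nu‖ * t)) := by ring
    _ ≤ ‖z‖ * Real.exp (-t) + ‖nu‖ * Real.exp (-t) := by gcongr
    _ = (‖z‖ + ‖nu‖) * Real.exp (-t) := by ring

/-- The modified Bessel equation `z² K'' + z K' = (z² + ν²) K`, in terms of moments. -/
theorem besselKMoment_bessel_equation (nu : ℂ) {z : ℂ} (hz : 0 < z.re) :
    z ^ 2 * besselKMoment 2 nu z - z * besselKMoment 1 nu z =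
      (z ^ 2 + nu ^ 2) * besselKMoment 0 nu z := by
  have hi (k : ℕ) := integrableOn_besselKMoment_integrand k nu hz
  have hint := (((hi 2).const_mul (z ^ 2)).sub ((hi 1).const_mul z)).sub
    ((hi 0).const_mul (z ^ 2 + nu ^ 2))
  have hderiv (t : ℝ) : HasDerivAt (fun t : ℝ =>
      -z * Complex.sinh t * Complex.exp (-z * Complex.cosh t) * Complex.cosh (nu * t) -
        Complex.exp (-z * Complex.cosh t) * (nu * Complex.sinh (nu * t)))
      ((z ^ 2 * ((Real.cosh t : ℂ) ^ 2 *
        (Complex.exp (-z * (Real.cosh t : ℂ)) * Complex.cosh (nu * (t : ℂ)))) -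
        z * ((Real.cosh t : ℂ) ^ 1 *
        (Complex.exp (-z * (Real.cosh t : ℂ)) * Complex.cosh (nu * (t : ℂ))))) -
        (z ^ 2 + nu ^ 2) * ((Real.cosh t : ℂ) ^ 0 *
        (Complex.exp (-z * (Real.cosh t : ℂ)) * Complex.cosh (nu * (t : ℂ))))) t := by
    have hs : HasDerivAt (fun w : ℂ => -z * Complex.sinh w) (-z * Complex.cosh t) t :=
      (Complex.hasDerivAt_sinh t).const_mul (-z)
    have hE : HasDerivAt (fun w : ℂ => Complex.exp (-z * Complex.cosh w))
        (Complex.exp (-z * Complex.cosh t) * (-z * Complex.sinh t)) t :=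
      ((Complex.hasDerivAt_cosh t).const_mul (-z)).cexp
    have hn : HasDerivAt (fun w : ℂ => nu * w) nu t := by
      simpa using (hasDerivAt_id (t : ℂ)).const_mul nu
    have h := ((hs.mul hE).mul hn.ccosh).sub (hE.mul (hn.csinh.const_mul nu))
    refine h.comp_ofReal.congr_deriv ?_
    simp only [Pi.mul_apply]
    push_cast
    linear_combination (-z ^ 2 * Complex.exp (-z * Complex.cosh t) * Complex.cosh (nu * t)) *
      Complex.cosh_sq_sub_sinh_sq (t : ℂ)
  have hftc := integral_Ioi_of_hasDerivAt_of_tendsto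
    (hderiv 0).continuousAt.continuousWithinAt (fun t _ => hderiv t) hint
    (tendsto_besselK_boundary_term nu hz)
  simp only [besselKMoment]
  have hsplit {f g h : ℝ → ℂ} (hf : IntegrableOn f (Ioi 0)) (hg : IntegrableOn g (Ioi 0))
      (hh : IntegrableOn h (Ioi 0)) : ∫ t in Ioi (0:ℝ), f t - g t - h t =
      (∫ t in Ioi (0:ℝ), f t) - (∫ t in Ioi (0:ℝ), g t) - ∫ t in Ioi (0:ℝ), h t := by
    rw [← integral_sub hf hg]
    exact integral_sub (hf.sub hg) hh
  rw [hsplit ((hi 2).const_mul (z ^ 2)) ((hi 1).const_mul z)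
    ((hi 0).const_mul (z ^ 2 + nu ^ 2))] at hftc
  simp only [integral_const_mul] at hftc
  rw [← sub_eq_zero, hftc]
  simp

theorem hasDerivAt_two_mul_four_mul_rpow {y : ℝ} (hy : 0 < y) :
    HasDerivAt (fun y : ℝ => 2 * (4 * y) ^ ((1:ℝ) / 4))
      (2 * (4 * y) ^ ((1:ℝ) / 4) / (4 * y)) y := by
  have h := (((hasDerivAt_id y).const_mul 4).rpow_const (p := (1:ℝ) / 4)
    (Or.inl (by simp [hy.ne']))).const_mul 2
  refine h.congr_deriv ?_
  simp only [id]
  rw [Real.rpow_sub_one (by positivity)]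
  field_simp

theorem two_mul_four_mul_rpow_sq {y : ℝ} (hy : 0 < y) :
    (2 * (4 * y) ^ ((1:ℝ) / 4)) ^ 2 = 8 * Real.sqrt y := by
  have h : ((4 * y) ^ ((1:ℝ) / 4)) ^ 2 = 2 * Real.sqrt y := by
    rw [← Real.rpow_natCast, ← Real.rpow_mul (by positivity)]
    norm_num
    rw [← Real.sqrt_eq_rpow, Real.sqrt_mul (by norm_num), show (4:ℝ) = 2 ^ 2 by norm_num,
      Real.sqrt_sq (by norm_num)]
  rw [mul_pow, h]
  ring

section Ray

variable (nu e : ℂ)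

/-- The Bessel function along the ray through `e`, in the kernel's variable. -/
noncomputable def besselKRay (y : ℝ) : ℂ :=
  besselK nu (((2 * (4 * y) ^ ((1:ℝ) / 4) : ℝ) : ℂ) * e)

/-- The image of `besselKRay` under `4 y · d/dy`. -/
noncomputable def besselKRayEuler (y : ℝ) : ℂ :=
  -((((2 * (4 * y) ^ ((1:ℝ) / 4) : ℝ) : ℂ) * e) *
    besselKMoment 1 nu (((2 * (4 * y) ^ ((1:ℝ) / 4) : ℝ) : ℂ) * e))

variable {e}

theorem ray_re_pos (he : 0 < e.re) {y : ℝ} (hy : 0 < y) :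
    0 < (((2 * (4 * y) ^ ((1:ℝ) / 4) : ℝ) : ℂ) * e).re := by
  rw [Complex.re_ofReal_mul]
  positivity

theorem hasDerivAt_ray {y : ℝ} (hy : 0 < y) :
    HasDerivAt (fun y : ℝ => ((2 * (4 * y) ^ ((1:ℝ) / 4) : ℝ) : ℂ) * e)
      (((2 * (4 * y) ^ ((1:ℝ) / 4) : ℝ) : ℂ) * e / (4 * y)) y := by
  refine ((hasDerivAt_two_mul_four_mul_rpow hy).ofReal_comp.mul_const e).congr_deriv ?_
  push_cast
  ring

theorem hasDerivAt_besselKRay (he : 0 < e.re) {y : ℝ} (hy : 0 < y) :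
    HasDerivAt (besselKRay nu e) (besselKRayEuler nu e y / (4 * y)) y := by
  have h := (hasDerivAt_besselKMoment 0 nu (ray_re_pos he hy)).comp y (hasDerivAt_ray hy)
  have hf : besselKMoment 0 nu ∘ (fun y : ℝ => ((2 * (4 * y) ^ ((1:ℝ) / 4) : ℝ) : ℂ) * e) =
      besselKRay nu e := by
    ext y
    simp only [Function.comp, besselKMoment_zero, besselKRay]
  rw [hf] at h
  refine h.congr_deriv ?_
  rw [besselKRayEuler]
  ring

theorem hasDerivAt_besselKRayEuler (he : 0 < e.re) {y : ℝ} (hy : 0 < y) :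
    HasDerivAt (besselKRayEuler nu e)
      ((8 * Real.sqrt y * e ^ 2 + nu ^ 2) * besselKRay nu e y / (4 * y)) y := by
  have hre := ray_re_pos he hy
  have hz := hasDerivAt_ray (e := e) hy
  refine (hz.mul ((hasDerivAt_besselKMoment 1 nu hre).comp y hz)).neg.congr_deriv ?_
  have hode := besselKMoment_bessel_equation nu hre
  have hsq := congrArg (fun r : ℝ => (r : ℂ)) (two_mul_four_mul_rpow_sq hy)
  simp only [Complex.ofReal_pow, Complex.ofReal_mul, Complex.ofReal_ofNat] at hsq
  rw [besselKMoment_zero] at hode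
  rw [besselKRay]
  simp only [Function.comp, Complex.ofReal_mul, Complex.ofReal_ofNat] at hode ⊢
  generalize besselK nu _ = K0 at *
  generalize besselKMoment 1 nu _ = K1 at *
  generalize besselKMoment 2 nu _ = K2 at *
  rw [mul_pow, hsq] at hode
  rw [← hode, ← hsq]
  ring

end Ray

theorem exp_I_pi_div_four_re_pos : 0 < (Complex.exp (Complex.I * (Real.pi:ℂ) / 4)).re := by
  rw [show Complex.I * (Real.pi:ℂ) / 4 = ((Real.pi / 4 : ℝ) : ℂ) * Complex.I by push_cast; ring,
    Complex.exp_ofReal_mul_I_re, Real.cos_pi_div_four]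
  positivity

theorem exp_neg_I_pi_div_four_re_pos :
    0 < (Complex.exp (-(Complex.I * (Real.pi:ℂ)) / 4)).re := by
  rw [show -(Complex.I * (Real.pi:ℂ)) / 4 = ((-(Real.pi / 4) : ℝ) : ℂ) * Complex.I by
      push_cast; ring,
    Complex.exp_ofReal_mul_I_re, Real.cos_neg, Real.cos_pi_div_four]
  positivity

theorem exp_I_pi_div_four_sq : Complex.exp (Complex.I * (Real.pi:ℂ) / 4) ^ 2 = Complex.I := by
  rw [← Complex.exp_nat_mul]
  refine Eq.trans (congrArg Complex.exp ?_) Complex.exp_pi_div_two_mul_I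
  push_cast
  ring

theorem exp_neg_I_pi_div_four_sq :
    Complex.exp (-(Complex.I * (Real.pi:ℂ)) / 4) ^ 2 = -Complex.I := by
  rw [← Complex.exp_nat_mul]
  refine Eq.trans (congrArg Complex.exp ?_) Complex.exp_neg_pi_div_two_mul_I
  push_cast
  ring

theorem HasDerivAt.complex_re {f : ℝ → ℂ} {f' : ℂ} {y : ℝ} (h : HasDerivAt f f' y) :
    HasDerivAt (fun y => (f y).re) f'.re y :=
  Complex.reCLM.hasFDerivAt.comp_hasDerivAt y h

/-- A solution pair of `(4 x d/dx)² a = (8 i √x − 4 τ²) a`, `(4 x d/dx)² b = (−8 i √x − 4 τ²) b`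
has a product `u = a b` whose real part satisfies the fourth-order operator identity. -/
theorem product_operator_identity {τ : ℝ} {a A b B : ℝ → ℂ} {u : ℝ → ℝ}
    (hu : ∀ y, u y = (a y * b y).re)
    (ha : ∀ y, 0 < y → HasDerivAt a (A y / (4 * y)) y)
    (hA : ∀ y, 0 < y →
      HasDerivAt A ((8 * Real.sqrt y * Complex.I - 4 * τ ^ 2) * a y / (4 * y)) y)
    (hb : ∀ y, 0 < y → HasDerivAt b (B y / (4 * y)) y)
    (hB : ∀ y, 0 < y →
      HasDerivAt B ((-(8 * Real.sqrt y * Complex.I) - 4 * τ ^ 2) * b y / (4 * y)) y)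
    {x : ℝ} (hx : 0 < x) :
    deriv (fun y => Real.sqrt y * deriv (fun y =>
        y * deriv (fun z => z * deriv u z) y + τ ^ 2 * u y) y) x
      = x ^ (-(1:ℝ) / 2) * u x := by
  have hpos {y : ℝ} (hy : 0 < y) : ∀ᶠ z in nhds y, 0 < z := eventually_gt_nhds hy
  have h1 {y : ℝ} (hy : 0 < y) : y * deriv u y = ((A y * b y + a y * B y) / 4).re := by
    have hy' : (y : ℂ) ≠ 0 := by exact_mod_cast hy.ne'
    have hd : deriv (fun z => (a z * b z).re) y = _ :=
      ((ha y hy).mul (hb y hy)).complex_re.deriv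
    rw [funext hu, hd, ← Complex.re_ofReal_mul]
    congr 1
    field_simp
  have h2 {y : ℝ} (hy : 0 < y) : y * deriv (fun z => z * deriv u z) y + τ ^ 2 * u y =
      ((τ ^ 2 / 2 : ℂ) * (a y * b y) + A y * B y / 8).re := by
    have hy' : (y : ℂ) ≠ 0 := by exact_mod_cast hy.ne'
    have hd := ((((hA y hy).mul (hb y hy)).add ((ha y hy).mul (hB y hy))).div_const 4).complex_re
    rw [(hd.congr_of_eventuallyEq ((hpos hy).mono fun z hz => h1 hz)).deriv, hu,
      ← Complex.ofReal_pow, ← Complex.re_ofReal_mul, ← Complex.re_ofReal_mul, ← Complex.add_re]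
    congr 1
    push_cast
    field_simp
    ring
  have h3 {y : ℝ} (hy : 0 < y) : Real.sqrt y * deriv (fun y =>
      y * deriv (fun z => z * deriv u z) y + τ ^ 2 * u y) y =
      (Complex.I / 4 * (a y * B y - A y * b y)).re := by
    have hy' : (y : ℂ) ≠ 0 := by exact_mod_cast hy.ne'
    have hs : (Real.sqrt y : ℂ) ^ 2 = y := by exact_mod_cast Real.sq_sqrt hy.le
    have hd := ((((ha y hy).mul (hb y hy)).const_mul (τ ^ 2 / 2 : ℂ)).add
      (((hA y hy).mul (hB y hy)).div_const 8)).complex_re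
    rw [(hd.congr_of_eventuallyEq ((hpos hy).mono fun z hz => h2 hz)).deriv,
      ← Complex.re_ofReal_mul]
    congr 1
    field_simp
    linear_combination (16 * Complex.I * (a y * B y - A y * b y)) * hs
  have hx' : (x : ℂ) ≠ 0 := by exact_mod_cast hx.ne'
  have hd := ((((ha x hx).mul (hB x hx)).sub ((hA x hx).mul (hb x hx))).const_mul
    (Complex.I / 4)).complex_re
  have hr : x ^ (-(1:ℝ) / 2) = Real.sqrt x / x := by
    rw [show -(1:ℝ) / 2 = 1 / 2 - 1 by norm_num, Real.rpow_sub_one hx.ne', Real.sqrt_eq_rpow]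
  rw [(hd.congr_of_eventuallyEq ((hpos hx).mono fun z hz => h3 hz)).deriv, hu, hr,
    ← Complex.re_ofReal_mul]
  congr 1
  push_cast
  field_simp
  linear_combination (-16 * Real.sqrt x * a x * b x) * Complex.I_sq

/-- The operator identity (1.14):
(d/dx)(x^{1/2}(d/dx)) [ (x d/dx)² + τ² ] 𝒦(x,τ) = x^{−1/2} 𝒦(x,τ) on (0,∞),
where (x d/dx)²u = x·(x·u′)′. -/
theorem kernel_operator_identity (τ : ℝ) (x : ℝ) (hx : 0 < x) :
    deriv (fun y => Real.sqrt y * deriv (fun y =>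
        y * deriv (fun z => z * deriv (fun w => kernelK w τ) z) y + τ^2 * kernelK y τ) y) x
      = x ^ (-(1:ℝ)/2) * kernelK x τ := by
  refine product_operator_identity (u := fun w => kernelK w τ)
    (a := besselKRay (2 * Complex.I * τ) (Complex.exp (Complex.I * (Real.pi:ℂ) / 4)))
    (b := besselKRay (2 * Complex.I * τ) (Complex.exp (-(Complex.I * (Real.pi:ℂ)) / 4)))
    (fun _ => rfl)
    (fun y hy => hasDerivAt_besselKRay _ exp_I_pi_div_four_re_pos hy)
    (fun y hy => (hasDerivAt_besselKRayEuler _ exp_I_pi_div_four_re_pos hy).congr_deriv ?_)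
    (fun y hy => hasDerivAt_besselKRay _ exp_neg_I_pi_div_four_re_pos hy)
    (fun y hy => (hasDerivAt_besselKRayEuler _ exp_neg_I_pi_div_four_re_pos hy).congr_deriv ?_)
    hx
  · rw [exp_I_pi_div_four_sq, mul_pow, mul_pow, Complex.I_sq]
    ring
  · rw [exp_neg_I_pi_div_four_sq, mul_pow, mul_pow, Complex.I_sq]
    ring
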